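/- Let H be an infinite-dimensional complex separable Hilbert space with orthonormal basis (e_n)_{n≥1}, let x ∈ H, and define T_n ∈ B(H) by T_n(z) = ⟨z,e_n⟩ x. Then sup_{‖z‖=1} (Σ_{n≥1} ‖T_n(z)‖²)^{1/2} = ‖x‖, while for every t ∈ [0,2π) and every N ≥ 1 one has ‖Σ_{n=1}^N T_n e^{int}‖_{B(H)} = ‖x‖·√N. In particular, if x ≠ 0 then (T_n) satisfies ‖(T_n)‖_{ℓ²_SOT} < ∞ but ‖(T_n)‖_{H̃²(𝕋,B(H))} = ∞. -/

import Mathlib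

open scoped ENNReal NNReal InnerProductSpace
open MeasureTheory Complex

noncomputable section

variable {H : Type*} [NormedAddCommGroup H] [InnerProductSpace ℂ H] [CompleteSpace H]

/-- The `ℓ²_SOT` norm (squared, in `ℝ≥0∞`) of a sequence of operators:
`sup_{‖x‖=1} Σ_n ‖T_n x‖²`. -/
def sotNormSq (T : ℕ → H →L[ℂ] H) : ℝ≥0∞ :=
  ⨆ z : {z : H // ‖z‖ = 1}, ∑' n : ℕ, (‖T n (z : H)‖₊ : ℝ≥0∞) ^ 2

/-- The square of the `H̃²(𝕋, B(H))` norm of a sequence of operators (indices starting at `1`,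
so the entry `T n` carries the character `e^{i(n+1)t}`). -/
def h2SeqNormSq (T : ℕ → H →L[ℂ] H) : ℝ≥0∞ :=
  ⨆ N : ℕ,
    (∫⁻ t in Set.Ioc (0 : ℝ) (2 * Real.pi),
        ((‖∑ n ∈ Finset.range N, Complex.exp (((n : ℝ) + 1) * t * Complex.I) • T n‖₊ : ℝ≥0∞) ^ 2)) /
      ENNReal.ofReal (2 * Real.pi)

theorem row_norm_aux (e : HilbertBasis ℕ ℂ H) (x : H) (T : ℕ → H →L[ℂ] H)
    (hT : ∀ (n : ℕ) (z : H), T n z = ⟪e n, z⟫_ℂ • x) (c : ℕ → ℂ) (hc : ∀ n, ‖c n‖ = 1) (N : ℕ) :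
    ‖∑ n ∈ Finset.range N, c n • T n‖ = ‖x‖ * Real.sqrt N := by
  set v : H := ∑ n ∈ Finset.range N, (starRingEnd ℂ (c n)) • e n with hv
  have h1 : ∑ n ∈ Finset.range N, c n • T n = (innerSL ℂ v).smulRight x := by
    ext z
    simp [hT, hv, sum_inner, inner_smul_left, Finset.sum_smul, smul_smul]
  have h2 : ‖v‖ ^ 2 = N := by
    have h := e.orthonormal.inner_sum (fun n => starRingEnd ℂ (c n))
      (fun n => starRingEnd ℂ (c n)) (Finset.range N)
    rw [← hv, inner_self_eq_norm_sq_to_K] at h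
    simp [Complex.mul_conj, Complex.normSq_eq_norm_sq, hc] at h
    exact_mod_cast h
  rw [h1, ContinuousLinearMap.norm_smulRight_apply, innerSL_apply_norm, ← h2,
    Real.sqrt_sq (norm_nonneg _), mul_comm]

theorem row_sot_aux (e : HilbertBasis ℕ ℂ H) (x : H) (T : ℕ → H →L[ℂ] H)
    (hT : ∀ (n : ℕ) (z : H), T n z = ⟪e n, z⟫_ℂ • x) (z : H) (hz : ‖z‖ = 1) :
    ∑' n : ℕ, (‖T n z‖₊ : ℝ≥0∞) ^ 2 = (‖x‖₊ : ℝ≥0∞) ^ 2 := by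
  have hs : HasSum (fun n => ‖⟪e n, z⟫_ℂ‖ ^ 2) (1 : ℝ) := by
    have h := e.hasSum_inner_mul_inner z z
    rw [inner_self_eq_norm_sq_to_K, hz] at h
    rw [← Complex.hasSum_ofReal]
    have hf : (fun n => ((‖⟪e n, z⟫_ℂ‖ ^ 2 : ℝ) : ℂ)) = fun n => ⟪z, e n⟫_ℂ * ⟪e n, z⟫_ℂ := by
      funext n
      rw [← inner_conj_symm z (e n), Complex.conj_mul']
      simp
    rw [hf]
    simpa using h
  have h3 : ∑' n : ℕ, (‖⟪e n, z⟫_ℂ‖₊ : ℝ≥0∞) ^ 2 = 1 := by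
    have h4 := ENNReal.ofReal_tsum_of_nonneg (fun n => sq_nonneg ‖⟪e n, z⟫_ℂ‖) hs.summable
    rw [hs.tsum_eq, ENNReal.ofReal_one] at h4
    rw [h4]
    congr 1
    ext n
    rw [ENNReal.ofReal_pow (norm_nonneg _), ofReal_norm_eq_enorm, enorm_eq_nnnorm]
  simp only [hT, nnnorm_smul, ENNReal.coe_mul, mul_pow]
  rw [ENNReal.tsum_mul_right, h3, one_mul]

theorem rank_one_row_example
    (e : HilbertBasis ℕ ℂ H) (x : H) (T : ℕ → H →L[ℂ] H)
    (hT : ∀ (n : ℕ) (z : H), T n z = ⟪e n, z⟫_ℂ • x) :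
    sotNormSq T = (‖x‖₊ : ℝ≥0∞) ^ 2 ∧
    (∀ t ∈ Set.Ico (0 : ℝ) (2 * Real.pi), ∀ N : ℕ, 1 ≤ N →
      ‖∑ n ∈ Finset.range N, Complex.exp (((n : ℝ) + 1) * t * Complex.I) • T n‖ =
        ‖x‖ * Real.sqrt N) ∧
    (x ≠ 0 → sotNormSq T < ⊤ ∧ h2SeqNormSq T = ⊤) := by
  have hsot : sotNormSq T = (‖x‖₊ : ℝ≥0∞) ^ 2 := by
    have : Nonempty {z : H // ‖z‖ = 1} := ⟨⟨e 0, e.orthonormal.1 0⟩⟩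
    unfold sotNormSq
    rw [iSup_congr (fun z : {z : H // ‖z‖ = 1} => row_sot_aux e x T hT z z.2), iSup_const]
  have hn : ∀ (t : ℝ) (N : ℕ),
      ‖∑ n ∈ Finset.range N, Complex.exp (((n : ℝ) + 1) * t * Complex.I) • T n‖ =
        ‖x‖ * Real.sqrt N := by
    intro t N
    refine row_norm_aux e x T hT
      (fun n => Complex.exp (((n : ℝ) + 1) * t * Complex.I)) (fun n => ?_) N
    have := Complex.norm_exp_ofReal_mul_I (((n : ℝ) + 1) * t)
    push_cast at this ⊢
    exact this
  refine ⟨hsot, fun t _ N _ => hn t N, fun hx => ⟨?_, ?_⟩⟩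
  · rw [hsot]
    exact ENNReal.pow_lt_top ENNReal.coe_lt_top
  · have hpi : ENNReal.ofReal (2 * Real.pi) ≠ 0 := by
      simp [Real.pi_pos]
    have hval : ∀ N : ℕ, (∫⁻ t in Set.Ioc (0 : ℝ) (2 * Real.pi),
        ((‖∑ n ∈ Finset.range N, Complex.exp (((n : ℝ) + 1) * t * Complex.I) • T n‖₊ : ℝ≥0∞) ^ 2)) /
        ENNReal.ofReal (2 * Real.pi) = (‖x‖₊ : ℝ≥0∞) ^ 2 * (N : ℝ≥0∞) := by
      intro N
      have hc : ∀ t : ℝ,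
          (‖∑ n ∈ Finset.range N, Complex.exp (((n : ℝ) + 1) * t * Complex.I) • T n‖₊ : ℝ≥0∞) ^ 2
            = (‖x‖₊ : ℝ≥0∞) ^ 2 * (N : ℝ≥0∞) := by
        intro t
        rw [← enorm_eq_nnnorm, ← ofReal_norm_eq_enorm, hn t N,
          ← ENNReal.ofReal_pow (by positivity), mul_pow, Real.sq_sqrt (Nat.cast_nonneg N),
          ENNReal.ofReal_mul (by positivity), ENNReal.ofReal_pow (norm_nonneg _),
          ofReal_norm_eq_enorm, enorm_eq_nnnorm, ENNReal.ofReal_natCast]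
      simp_rw [hc]
      rw [lintegral_const, Measure.restrict_apply_univ, Real.volume_Ioc, sub_zero,
        ENNReal.mul_div_cancel_right hpi ENNReal.ofReal_ne_top]
    unfold h2SeqNormSq
    simp_rw [hval]
    rw [← ENNReal.mul_iSup, ENNReal.iSup_natCast, ENNReal.mul_top]
    simpa using hx

end
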